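/- Let X be a real normed space, x† ∈ X, and x₁, …, x_m ∈ X. Let φ, ψ : {1, …, m} → [0, ∞) with φ nondecreasing and ψ nonincreasing, and suppose ‖x_i − x†‖ ≤ φ(i) + ψ(i) for every i. Assume the set {j : φ(j) ≤ ψ(j)} is nonempty and let j* be its maximum. Define the Lepskii index j̄ = max{ j ≤ m : ‖x_i − x_j‖ ≤ 4ψ(i) for all i ≤ j } (this set contains j = 1, so j̄ is well defined). Then j̄ ≥ j* and ‖x_{j̄} − x†‖ ≤ 6 ψ(j*). -/

import Mathlib

/-- Deterministic Lepskii balancing lemma.  For elements `x₁, …, x_m` of a normed space,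
a nondecreasing bound `φ` and a nonincreasing bound `ψ` (both nonnegative on `{1,…,m}`)
with `‖x i - x†‖ ≤ φ i + ψ i`, let `j*` be the largest index with `φ j ≤ ψ j` (assumed to
exist) and let `j̄` be the Lepskii index, the largest `j ≤ m` with `‖x i - x j‖ ≤ 4 ψ i`
for all `i ≤ j`.  Then `j* ≤ j̄` and `‖x j̄ - x†‖ ≤ 6 ψ j*`. -/
theorem lepskii_balancing {X : Type*} [NormedAddCommGroup X]
    (m : ℕ) (hm : 1 ≤ m) (xdag : X) (x : ℕ → X) (φ ψ : ℕ → ℝ)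
    (hφ0 : ∀ i ∈ Set.Icc 1 m, 0 ≤ φ i) (hψ0 : ∀ i ∈ Set.Icc 1 m, 0 ≤ ψ i)
    (hφmono : MonotoneOn φ (Set.Icc 1 m)) (hψanti : AntitoneOn ψ (Set.Icc 1 m))
    (herr : ∀ i ∈ Set.Icc 1 m, ‖x i - xdag‖ ≤ φ i + ψ i)
    (hne : {j | j ∈ Set.Icc 1 m ∧ φ j ≤ ψ j}.Nonempty)
    (jstar : ℕ) (hjstar : jstar = sSup {j | j ∈ Set.Icc 1 m ∧ φ j ≤ ψ j})
    (jbar : ℕ)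
    (hjbar : jbar = sSup {j | j ∈ Set.Icc 1 m ∧
      ∀ i ∈ Set.Icc 1 j, ‖x i - x j‖ ≤ 4 * ψ i}) :
    jstar ≤ jbar ∧ ‖x jbar - xdag‖ ≤ 6 * ψ jstar := by
  have b1 : BddAbove {j | j ∈ Set.Icc 1 m ∧ φ j ≤ ψ j} := ⟨m, fun j hj => hj.1.2⟩
  have b2 : BddAbove {j | j ∈ Set.Icc 1 m ∧
      ∀ i ∈ Set.Icc 1 j, ‖x i - x j‖ ≤ 4 * ψ i} := ⟨m, fun j hj => hj.1.2⟩
  have h1 := Nat.sSup_mem hne b1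
  rw [← hjstar] at h1
  obtain ⟨hs, hle⟩ := h1
  have hmem : jstar ∈ {j | j ∈ Set.Icc 1 m ∧
      ∀ i ∈ Set.Icc 1 j, ‖x i - x j‖ ≤ 4 * ψ i} := by
    refine ⟨hs, fun i hi => ?_⟩
    have him : i ∈ Set.Icc 1 m := ⟨hi.1, hi.2.trans hs.2⟩
    have e1 := herr i him
    have e2 := herr jstar hs
    have e3 := hφmono him hs hi.2
    have e4 := hψanti him hs hi.2
    have e5 := norm_sub_le_norm_sub_add_norm_sub (x i) xdag (x jstar)
    rw [norm_sub_rev xdag] at e5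
    linarith
  have h2 := Nat.sSup_mem ⟨_, hmem⟩ b2
  have hge := le_csSup b2 hmem
  rw [← hjbar] at h2 hge
  refine ⟨hge, ?_⟩
  have e1 := h2.2 jstar ⟨hs.1, hge⟩
  have e2 := herr jstar hs
  have e5 := norm_sub_le_norm_sub_add_norm_sub (x jbar) (x jstar) xdag
  rw [norm_sub_rev (x jbar) (x jstar)] at e5
  linarith
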